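/- Let α ∈ (1/2, 1/√2) and γ_α = 3/4 + α/(2√2). There exists a velocity U : [0,1]×ℝ² → ℝ² that is Lipschitz on [0,1]×ℝ², has compact support, and is weakly divergence free, such that its (unique) trajectory map X_U on ℝ² satisfies X_U(1, S_α) = γ_α · S_α, where γ_α · S_α := {γ_α x : x ∈ S_α}. -/

import Mathlib

open Set

noncomputable section

/-- Rotation by `π/2` about the origin. -/
def Rot (x : ℝ × ℝ) : ℝ × ℝ := (-x.2, x.1)

/-- The affine map `F₁ x = (1,0) + α R x`. -/
def F1 (α : ℝ) (x : ℝ × ℝ) : ℝ × ℝ := ((1 : ℝ), 0) + α • Rot x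

/-- The affine map `F₂ x = (-1,0) + α R x`. -/
def F2 (α : ℝ) (x : ℝ × ℝ) : ℝ × ℝ := ((-1 : ℝ), 0) + α • Rot x

/-- `F₁` or `F₂`, indexed by a letter of the alphabet `{1, 2}` (as a `Bool`,
`true ↦ F₁`, `false ↦ F₂`). -/
def Fb (α : ℝ) (b : Bool) : ℝ × ℝ → ℝ × ℝ := if b then F1 α else F2 α

/-- For a finite word `w = (w₁, …, w_k)` (a `List Bool`), the composition
`F_w = F_{w₁} ∘ … ∘ F_{w_k}`; the empty word gives the identity. -/
def Fw (α : ℝ) (w : List Bool) : ℝ × ℝ → ℝ × ℝ :=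
  w.foldr (fun b f => Fb α b ∘ f) id

/-- The segment `I = [-1,1] × {0}`. -/
def ISeg : Set (ℝ × ℝ) := Icc (-1 : ℝ) 1 ×ˢ ({0} : Set ℝ)

/-- The inhomogeneous self-similar set `S_α`: the closure of the union of the images
of `I` under all the maps `F_w`, `w` a finite word in `{1,2}`. -/
def Sset (α : ℝ) : Set (ℝ × ℝ) := closure (⋃ w : List Bool, Fw α w '' ISeg)


/-- Dot product on `ℝ × ℝ`. -/
def dot2 (u v : ℝ × ℝ) : ℝ := u.1 * v.1 + u.2 * v.2

/-- Spatial gradient of a scalar function on `ℝ × ℝ`. -/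
def grad2 (ψ : ℝ × ℝ → ℝ) (x : ℝ × ℝ) : ℝ × ℝ :=
  (fderiv ℝ ψ x (1, 0), fderiv ℝ ψ x (0, 1))

/-- A velocity field is weakly divergence free at time `t`. -/
def WeakDivFreeAt (u : ℝ → ℝ × ℝ → ℝ × ℝ) (t : ℝ) : Prop :=
  ∀ ψ : ℝ × ℝ → ℝ, ContDiff ℝ (⊤ : ℕ∞) ψ → HasCompactSupport ψ →
    ∫ x, dot2 (u t x) (grad2 ψ x) = 0

/-- Trajectory map of a velocity field on a set `A`, on the time interval `[0,T]`. -/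
def IsTrajOn (T : ℝ) (U : ℝ → ℝ × ℝ → ℝ × ℝ) (A : Set (ℝ × ℝ))
    (X : ℝ → ℝ × ℝ → ℝ × ℝ) : Prop :=
  ∀ a ∈ A, X 0 a = a ∧
    ∀ t ∈ Icc (0 : ℝ) T, HasDerivWithinAt (fun s => X s a) (U t (X t a)) (Icc (0 : ℝ) T) t

section Flow

variable {E : Type*} [NormedAddCommGroup E] [NormedSpace ℝ E] {v : ℝ → E → E} {K : NNReal}

/-- `f` is an integral curve of the time-dependent vector field `v` on `[0, 1]`. -/
def IsUnitCurve (v : ℝ → E → E) (f : ℝ → E) : Prop :=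
  ∀ t ∈ Icc (0 : ℝ) 1, HasDerivWithinAt f (v t (f t)) (Icc (0 : ℝ) 1) t

theorem IsUnitCurve.continuousOn {f : ℝ → E} (hf : IsUnitCurve v f) :
    ContinuousOn f (Icc (0 : ℝ) 1) :=
  fun t ht => (hf t ht).continuousWithinAt

theorem IsUnitCurve.hasDerivWithinAt_Ici {f : ℝ → E} (hf : IsUnitCurve v f) :
    ∀ t ∈ Ico (0 : ℝ) 1, HasDerivWithinAt f (v t (f t)) (Ici t) t := fun t ht =>
  (hf t (Ico_subset_Icc_self ht)).mono_of_mem_nhdsWithin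
    (Filter.mem_of_superset (Icc_mem_nhdsGE ht.2) (Icc_subset_Icc_left ht.1))

theorem IsUnitCurve.hasDerivWithinAt_Iic {f : ℝ → E} (hf : IsUnitCurve v f) :
    ∀ t ∈ Ioc (0 : ℝ) 1, HasDerivWithinAt f (v t (f t)) (Iic t) t := fun t ht =>
  (hf t (Ioc_subset_Icc_self ht)).mono_of_mem_nhdsWithin
    (Filter.mem_of_superset (Icc_mem_nhdsLE ht.1) (Icc_subset_Icc_right ht.2))

theorem IsUnitCurve.dist_le (hv : ∀ t, LipschitzWith K (v t)) {f g : ℝ → E}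
    (hf : IsUnitCurve v f) (hg : IsUnitCurve v g) {t : ℝ} (ht : t ∈ Icc (0 : ℝ) 1) :
    dist (f t) (g t) ≤ dist (f 0) (g 0) * Real.exp (K * (t - 0)) :=
  dist_le_of_trajectories_ODE hv hf.continuousOn hf.hasDerivWithinAt_Ici hg.continuousOn
    hg.hasDerivWithinAt_Ici le_rfl t ht

theorem IsUnitCurve.eqOn (hv : ∀ t, LipschitzWith K (v t)) {f g : ℝ → E}
    (hf : IsUnitCurve v f) (hg : IsUnitCurve v g) (h0 : f 0 = g 0) {t : ℝ}
    (ht : t ∈ Icc (0 : ℝ) 1) : f t = g t := by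
  have h := hf.dist_le hv hg ht
  rw [h0, dist_self, zero_mul] at h
  exact dist_le_zero.mp h

theorem IsUnitCurve.eq_zero_of_eq (hv : ∀ t, LipschitzWith K (v t)) {f g : ℝ → E}
    (hf : IsUnitCurve v f) (hg : IsUnitCurve v g) {t : ℝ} (ht : t ∈ Icc (0 : ℝ) 1)
    (h : f t = g t) : f 0 = g 0 := by
  have hsub : Ioc 0 t ⊆ Ioc (0 : ℝ) 1 := Ioc_subset_Ioc_right ht.2
  exact ODE_solution_unique_of_mem_Icc_left (v := v) (K := K) (s := fun _ => univ) (a := 0) (b := t)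
    (fun s _ => (hv s).lipschitzOnWith)
    (hf.continuousOn.mono (Icc_subset_Icc_right ht.2))
    (fun s hs => hf.hasDerivWithinAt_Iic s (hsub hs)) (fun _ _ => mem_univ _)
    (hg.continuousOn.mono (Icc_subset_Icc_right ht.2))
    (fun s hs => hg.hasDerivWithinAt_Iic s (hsub hs)) (fun _ _ => mem_univ _) h
    (left_mem_Icc.mpr ht.1)

theorem exists_isUnitCurve [CompleteSpace E] (hv : ∀ t, LipschitzWith K (v t))
    (hc : ∀ x, ContinuousOn (fun t => v t x) (Icc 0 1)) {B : NNReal}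
    (hB : ∀ t x, ‖v t x‖ ≤ B) (a : E) : ∃ f : ℝ → E, f 0 = a ∧ IsUnitCurve v f := by
  have h : IsPicardLindelof v (tmin := 0) (tmax := 1) ⟨0, by simp⟩ a B 0 B K :=
    { lipschitzOnWith := fun t _ => (hv t).lipschitzOnWith
      continuousOn := fun x _ => hc x
      norm_le := fun t _ x _ => hB t x
      mul_max_le := by simp }
  exact h.exists_eq_forall_mem_Icc_hasDerivWithinAt₀

end Flow

section Seed

open Filter Topology

theorem exists_odd_cutoff {p q : ℝ} (hp : 0 < p) (hpq : p ≤ q) (hq : q < 2) :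
    ∃ h : ℝ → ℝ, ContDiff ℝ 2 h ∧ (∀ x, h (-x) = -h x) ∧
      (∀ x ∈ Icc p q, h =ᶠ[𝓝 x] fun _ => 1) ∧ ∀ x, 2 < |x| → h =ᶠ[𝓝 x] fun _ => 0 := by
  have h1 : max (1 - p) (q - 1) < 1 := max_lt (by linarith) (by linarith)
  have h2 := le_max_left (1 - p) (q - 1)
  have h3 := le_max_right (1 - p) (q - 1)
  set M := max (1 - p) (q - 1)
  let f : ContDiffBump (1 : ℝ) := ⟨(1 + M) / 2, 1, by linarith, by linarith⟩
  have hzero : ∀ x : ℝ, 1 ≤ |x - 1| → f x = 0 := fun x hx =>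
    f.zero_of_le_dist (by rw [Real.dist_eq]; exact hx)
  refine ⟨fun x => f x - f (-x), ?_, fun x => ?_, fun x hx => ?_, fun x hx => ?_⟩
  · exact f.contDiff.sub (f.contDiff.comp contDiff_neg)
  · simp
  · have e1 : ∀ᶠ y in 𝓝 x, f y = 1 := f.eventuallyEq_one_of_mem_ball (by
      rw [Metric.mem_ball, Real.dist_eq, abs_lt]
      change -((1 + M) / 2) < x - 1 ∧ x - 1 < (1 + M) / 2
      constructor <;> linarith [hx.1, hx.2])
    filter_upwards [e1, lt_mem_nhds (lt_of_lt_of_le hp hx.1)] with y hy hy0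
    rw [hy, hzero (-y) (by rw [abs_of_neg] <;> linarith), sub_zero]
  · filter_upwards [(isOpen_lt continuous_const continuous_abs).mem_nhds hx] with y hy
    have hy : 2 < |y| := hy
    have hy1 : 1 ≤ |y - 1| := by
      have := abs_sub_abs_le_abs_sub y 1
      rw [abs_one] at this; linarith
    have hy2 : 1 ≤ |-y - 1| := by
      have := abs_sub_abs_le_abs_sub (-y) 1
      rw [abs_one, abs_neg] at this; linarith
    rw [hzero y hy1, hzero (-y) hy2, sub_zero]

theorem exists_odd_truncated_id {p q : ℝ} (hp : 0 ≤ p) (hpq : p < q) :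
    ∃ k : ℝ → ℝ, ContDiff ℝ 2 k ∧ (∀ x, k (-x) = -k x) ∧
      (∀ x, |x| ≤ p → k =ᶠ[𝓝 x] id) ∧ ∀ x, q < |x| → k =ᶠ[𝓝 x] fun _ => 0 := by
  let f : ContDiffBump (0 : ℝ) := ⟨(p + q) / 2, q, by linarith, by linarith⟩
  refine ⟨fun x => x * f x, contDiff_id.mul f.contDiff, fun x => ?_, fun x hx => ?_, fun x hx => ?_⟩
  · simp [f.neg]
  · have e1 : ∀ᶠ y in 𝓝 x, f y = 1 := f.eventuallyEq_one_of_mem_ball (by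
      rw [Metric.mem_ball, Real.dist_eq, sub_zero]
      change |x| < (p + q) / 2
      linarith)
    filter_upwards [e1] with y hy
    simp [hy]
  · filter_upwards [(isOpen_lt continuous_const continuous_abs).mem_nhds hx] with y hy
    have : f y = 0 := f.zero_of_le_dist (by
      rw [Real.dist_eq, sub_zero]
      exact le_of_lt hy)
    rw [this, mul_zero]

/-- The sign attached to a letter. -/
def letterSign (b : Bool) : ℝ := if b then 1 else -1

/-- The box `[-2,2] × [-√2,√2]`, which contains its own images under the maps `frame`. -/
def Box : Set (ℝ × ℝ) := Icc (-2 : ℝ) 2 ×ˢ Icc (-√2) √2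

/-- The similarity `x ↦ (±g, 0) + α R x`. -/
def frame (α g : ℝ) (b : Bool) (y : ℝ × ℝ) : ℝ × ℝ := (letterSign b * g - α * y.2, α * y.1)

/-- The inverse of `frame`. -/
def unframe (α g : ℝ) (b : Bool) (x : ℝ × ℝ) : ℝ × ℝ :=
  (α⁻¹ * x.2, α⁻¹ * (letterSign b * g - x.1))

/-- The inequalities making the two images of the box disjoint subsets of the box. -/
structure IsAdmissible (α γ : ℝ) : Prop where
  pos : 0 < α
  lt_one : α < 1
  lt_gamma : √2 * α < γ
  gamma_lt : γ < 1
  lt_two : 1 + √2 * α < 2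
  lt_sqrt : 2 * α < √2

theorem IsAdmissible.frame_unframe {α γ : ℝ} (h : IsAdmissible α γ) (g : ℝ) (b : Bool) (x : ℝ × ℝ) :
    frame α g b (unframe α g b x) = x := by
  have := h.pos.ne'
  ext
  · simp only [frame, unframe]
    field_simp
    ring
  · simp only [frame, unframe]
    field_simp

theorem IsAdmissible.unframe_frame {α γ : ℝ} (h : IsAdmissible α γ) (g : ℝ) (b : Bool) (x : ℝ × ℝ) :
    unframe α g b (frame α g b x) = x := by
  have := h.pos.ne'
  ext <;> simp [frame, unframe] <;> field_simp

theorem IsAdmissible.bounds {α γ : ℝ} (h : IsAdmissible α γ) {g : ℝ} {b : Bool} {x : ℝ × ℝ}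
    (hx : unframe α g b x ∈ Box) : |x.2| ≤ 2 * α ∧ |letterSign b * g - x.1| ≤ √2 * α := by
  obtain ⟨⟨h1, h2⟩, h3, h4⟩ := hx
  have e := h.frame_unframe g b x
  set y := unframe α g b x
  have e2 : x.2 = α * y.1 := by rw [← e]; rfl
  have e1 : letterSign b * g - x.1 = α * y.2 := by rw [← e]; simp [frame]
  have := h.pos
  rw [e1, e2, abs_le, abs_le]
  refine ⟨⟨?_, ?_⟩, ?_, ?_⟩ <;> nlinarith

theorem IsAdmissible.mem_box {α γ : ℝ} (h : IsAdmissible α γ) {g : ℝ} (hg : g ∈ Icc γ 1) {b : Bool}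
    {x : ℝ × ℝ} (hx : unframe α g b x ∈ Box) : x ∈ Box := by
  obtain ⟨h1, h2⟩ := h.bounds hx
  rw [abs_le] at h1 h2
  have := h.lt_two
  have := h.lt_sqrt
  have := h.lt_gamma
  have := h.pos
  have := Real.sqrt_nonneg 2
  have := mul_nonneg (Real.sqrt_nonneg 2) h.pos.le
  refine ⟨⟨?_, ?_⟩, ?_, ?_⟩ <;> cases b <;> simp [letterSign] at h2 <;> linarith [hg.1, hg.2]

theorem IsAdmissible.not_mem_box {α γ : ℝ} (h : IsAdmissible α γ) {g g' : ℝ} (hg : g ∈ Icc γ 1)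
    (hg' : g' ∈ Icc γ 1) {b : Bool} {x : ℝ × ℝ} (hx : unframe α g b x ∈ Box) :
    unframe α g' (!b) x ∉ Box := by
  intro hx'
  obtain ⟨-, h2⟩ := h.bounds hx
  obtain ⟨-, h2'⟩ := h.bounds hx'
  rw [abs_le] at h2 h2'
  have := h.lt_gamma
  cases b <;> simp [letterSign] at h2 h2' <;> linarith [hg.1, hg.2, hg'.1, hg'.2]

/-- A `C¹` divergence-free field supported in the box, symmetric with respect to both axes, and
locally constant, equal to `∓(1 - γ)e₁`, near the images of the box. -/
structure IsSeed (α γ : ℝ) (u : ℝ × ℝ → ℝ × ℝ) : Prop where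
  contDiff : ContDiff ℝ 1 u
  eq_zero : ∀ x ∉ Box, u x = 0
  eventuallyEq : ∀ g ∈ Icc γ 1, ∀ b x, unframe α g b x ∈ Box →
    u =ᶠ[𝓝 x] fun _ => (-(letterSign b * (1 - γ)), 0)
  div : ∀ x, (fderiv ℝ u x (1, 0)).1 + (fderiv ℝ u x (0, 1)).2 = 0
  symm_fst : ∀ x, u (x.1, -x.2) = ((u x).1, -(u x).2)
  symm_snd : ∀ x, u (-x.1, x.2) = (-(u x).1, (u x).2)

theorem deriv_neg_of_odd {f : ℝ → ℝ} (hf : ∀ x, f (-x) = -f x) (x : ℝ) :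
    deriv f (-x) = deriv f x := by
  have h1 := deriv_comp_neg f x
  rw [show (fun x => f (-x)) = fun x => -f x from funext hf] at h1
  rw [deriv.fun_neg] at h1
  linarith

theorem IsAdmissible.exists_isSeed {α γ : ℝ} (h : IsAdmissible α γ) : ∃ u, IsSeed α γ u := by
  have h0 := h.pos
  have hs := mul_pos (Real.sqrt_pos.mpr (by norm_num : (0 : ℝ) < 2)) h.pos
  obtain ⟨f, f2, fodd, f1, f0⟩ := exists_odd_cutoff (p := γ - √2 * α) (q := 1 + √2 * α)
    (by linarith [h.lt_gamma]) (by linarith [h.gamma_lt]) h.lt_two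
  obtain ⟨k, k2, kodd, k1, k0⟩ := exists_odd_truncated_id (p := 2 * α) (q := √2)
    (by linarith) h.lt_sqrt
  have f'1 : ContDiff ℝ 1 (deriv f) := (contDiff_succ_iff_deriv (n := 1).mp f2).2.2
  have k'1 : ContDiff ℝ 1 (deriv k) := (contDiff_succ_iff_deriv (n := 1).mp k2).2.2
  have fd : ∀ x, HasDerivAt f (deriv f x) x := fun x =>
    (f2.differentiable (by norm_num) x).hasDerivAt
  have kd : ∀ x, HasDerivAt k (deriv k x) x := fun x =>
    (k2.differentiable (by norm_num) x).hasDerivAt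
  have f'd : ∀ x, HasDerivAt (deriv f) (deriv (deriv f) x) x := fun x =>
    (f'1.differentiable (by norm_num) x).hasDerivAt
  have k'd : ∀ x, HasDerivAt (deriv k) (deriv (deriv k) x) x := fun x =>
    (k'1.differentiable (by norm_num) x).hasDerivAt
  refine ⟨fun x => (-((1 - γ) * (f x.1 * deriv k x.2)), (1 - γ) * (deriv f x.1 * k x.2)),
    ?_, ?_, ?_, ?_, ?_, ?_⟩
  · have hf := f2.of_le (m := 1) (by norm_num)
    have hk := k2.of_le (m := 1) (by norm_num)
    fun_prop
  · intro x hx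
    by_cases hx1 : 2 < |x.1|
    · have e := f0 _ hx1
      simp [e.eq_of_nhds, e.deriv_eq]
    · have hx2 : √2 < |x.2| := by
        by_contra hx2
        exact hx ⟨abs_le.mp (not_lt.mp hx1), abs_le.mp (not_lt.mp hx2)⟩
      have e := k0 _ hx2
      simp [e.eq_of_nhds, e.deriv_eq]
  · intro g hg b x hx
    obtain ⟨h1, h2⟩ := h.bounds hx
    rw [abs_le] at h2
    have ek : k =ᶠ[𝓝 x.2] id := k1 _ h1
    have ek' : deriv k =ᶠ[𝓝 x.2] fun _ => 1 := by
      refine ek.deriv.trans (Eventually.of_forall fun y => ?_)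
      exact deriv_id y
    have ef : f =ᶠ[𝓝 x.1] fun _ => letterSign b := by
      cases b
      · simp only [letterSign, Bool.false_eq_true, if_false] at h2 ⊢
        have := f1 (-x.1) ⟨by linarith [hg.1], by linarith [hg.2]⟩
        filter_upwards [(continuous_neg.tendsto x.1).eventually this] with y hy
        rw [fodd] at hy
        linarith
      · simp only [letterSign, if_true] at h2 ⊢
        exact f1 x.1 ⟨by linarith [hg.1], by linarith [hg.2]⟩
    have ef' : deriv f =ᶠ[𝓝 x.1] fun _ => 0 := by
      refine ef.deriv.trans (Eventually.of_forall fun y => ?_)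
      simp
    filter_upwards [(continuous_fst.tendsto x).eventually ef,
      (continuous_fst.tendsto x).eventually ef',
      (continuous_snd.tendsto x).eventually ek'] with y h1 h2 h3
    simp only [h1, h2, h3]
    ext
    · simp
      ring
    · simp
  · intro x
    have d1 := (((fd x.1).comp_hasFDerivAt x (hasFDerivAt_fst (𝕜 := ℝ))).mul
      ((k'd x.2).comp_hasFDerivAt x (hasFDerivAt_snd (𝕜 := ℝ)))).const_mul (1 - γ)
    have d2 := (((f'd x.1).comp_hasFDerivAt x (hasFDerivAt_fst (𝕜 := ℝ))).mul
      ((kd x.2).comp_hasFDerivAt x (hasFDerivAt_snd (𝕜 := ℝ)))).const_mul (1 - γ)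
    have d := (d1.neg).prodMk d2
    erw [d.fderiv]
    simp
    ring
  · intro x
    simp [deriv_neg_of_odd kodd, kodd]
  · intro x
    simp [deriv_neg_of_odd fodd, fodd]


/-- One step of the self-similar construction of the velocity. -/
def fieldStep (α : ℝ) (u : ℝ × ℝ → ℝ × ℝ) (g : ℝ) (V : ℝ × ℝ → ℝ × ℝ) (x : ℝ × ℝ) : ℝ × ℝ :=
  u x + α • Rot (V (unframe α g true x)) + α • Rot (V (unframe α g false x))

theorem norm_Rot (x : ℝ × ℝ) : ‖Rot x‖ = ‖x‖ := by
  simp [Rot, Prod.norm_def, max_comm]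

theorem Rot_sub (x y : ℝ × ℝ) : Rot (x - y) = Rot x - Rot y := by
  ext <;> simp [Rot]; ring

theorem continuous_Rot : Continuous Rot := by
  unfold Rot
  fun_prop

theorem continuous_unframe (α g : ℝ) (b : Bool) : Continuous (unframe α g b) := by
  unfold unframe
  fun_prop

theorem fieldStep_eq_of_not_mem {α : ℝ} {u : ℝ × ℝ → ℝ × ℝ} {g : ℝ} {V : ℝ × ℝ → ℝ × ℝ}
    (hV : ∀ y ∉ Box, V y = 0) (b : Bool) {x : ℝ × ℝ} (hx : unframe α g (!b) x ∉ Box) :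
    fieldStep α u g V x = u x + α • Rot (V (unframe α g b x)) := by
  cases b
  · rw [fieldStep, hV (unframe α g true x) hx]
    simp [Rot]
  · rw [fieldStep, hV (unframe α g false x) hx]
    simp [Rot]

theorem isClosed_Box : IsClosed Box := isClosed_Icc.prod isClosed_Icc

theorem isCompact_Box : IsCompact Box := isCompact_Icc.prod isCompact_Icc

/-- Properties of the approximate velocities that are stable under `fieldStep`. -/
structure IsApproxField (K : ℝ) (V : ℝ × ℝ → ℝ × ℝ) : Prop where
  contDiff : ContDiff ℝ 1 V
  eq_zero : ∀ x ∉ Box, V x = 0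
  norm_fderiv_le : ∀ x, ‖fderiv ℝ V x‖ ≤ K
  div : ∀ x, (fderiv ℝ V x (1, 0)).1 + (fderiv ℝ V x (0, 1)).2 = 0
  symm_fst : ∀ x, V (x.1, -x.2) = ((V x).1, -(V x).2)
  symm_snd : ∀ x, V (-x.1, x.2) = (-(V x).1, (V x).2)

theorem IsSeed.exists_norm_fderiv_le {α γ : ℝ} {u : ℝ × ℝ → ℝ × ℝ} (hu : IsSeed α γ u) :
    ∃ K : ℝ, 0 ≤ K ∧ ∀ x, ‖fderiv ℝ u x‖ ≤ K := by
  have hc : HasCompactSupport (fderiv ℝ u) :=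
    (HasCompactSupport.intro isCompact_Box hu.eq_zero).fderiv ℝ
  obtain ⟨K, hK⟩ := hc.exists_bound_of_continuous (hu.contDiff.continuous_fderiv (by norm_num))
  exact ⟨K, (norm_nonneg _).trans (hK 0), hK⟩

theorem isApproxField_zero {K : ℝ} (hK : 0 ≤ K) : IsApproxField K 0 where
  contDiff := contDiff_const
  eq_zero := by simp
  norm_fderiv_le := by simpa using hK
  div := by simp
  symm_fst := by simp [Prod.zero_eq_mk]
  symm_snd := by simp [Prod.zero_eq_mk]

/-- `Rot` as a continuous linear map. -/
def rotL : ℝ × ℝ →L[ℝ] ℝ × ℝ :=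
  (-ContinuousLinearMap.snd ℝ ℝ ℝ).prod (ContinuousLinearMap.fst ℝ ℝ ℝ)

theorem rotL_apply (x : ℝ × ℝ) : rotL x = Rot x := rfl

theorem norm_rotL_le : ‖rotL‖ ≤ 1 :=
  rotL.opNorm_le_bound zero_le_one fun x => by rw [rotL_apply, norm_Rot, one_mul]

theorem hasFDerivAt_conj {α g : ℝ} {b : Bool} {V : ℝ × ℝ → ℝ × ℝ} {x : ℝ × ℝ}
    (hV : DifferentiableAt ℝ V (unframe α g b x)) (c : ℝ × ℝ) :
    HasFDerivAt (fun z => c + α • Rot (V (unframe α g b z)))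
      (α • rotL ∘L (fderiv ℝ V (unframe α g b x)) ∘L (-α⁻¹ • rotL)) x := by
  have h1 : HasFDerivAt (unframe α g b) (-α⁻¹ • rotL) x := by
    have e : unframe α g b = fun z => (0, α⁻¹ * (letterSign b * g)) + (-α⁻¹ • rotL) z := by
      funext z
      ext <;> simp [unframe, rotL_apply, Rot]; ring
    rw [e]
    exact (-α⁻¹ • rotL).hasFDerivAt.const_add _
  exact ((rotL.hasFDerivAt.comp x (hV.hasFDerivAt.comp x h1)).const_smul α).const_add c

theorem IsSeed.isApproxField_fieldStep {α γ : ℝ} (h : IsAdmissible α γ) {u : ℝ × ℝ → ℝ × ℝ}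
    (hu : IsSeed α γ u) {K : ℝ} (hK : ∀ x, ‖fderiv ℝ u x‖ ≤ K) {g : ℝ} (hg : g ∈ Icc γ 1)
    {V : ℝ × ℝ → ℝ × ℝ} (hV : IsApproxField K V) : IsApproxField K (fieldStep α u g V) := by
  have hα := h.pos
  have key : ∀ x, fderiv ℝ (fieldStep α u g V) x = fderiv ℝ u x ∨
      ∃ y, fderiv ℝ (fieldStep α u g V) x = α • rotL ∘L (fderiv ℝ V y) ∘L (-α⁻¹ • rotL) := by
    intro x
    by_cases hx : ∃ b, unframe α g b x ∈ Box
    · obtain ⟨b, hb⟩ := hx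
      right
      refine ⟨unframe α g b x, ?_⟩
      have e1 : ∀ᶠ z in 𝓝 x, unframe α g (!b) z ∉ Box :=
        (isClosed_Box.preimage (continuous_unframe α g (!b))).isOpen_compl.mem_nhds
          (h.not_mem_box hg hg hb)
      have e2 : fieldStep α u g V =ᶠ[𝓝 x] fun z => (-(letterSign b * (1 - γ)), 0) +
          α • Rot (V (unframe α g b z)) := by
        filter_upwards [e1, hu.eventuallyEq g hg b x hb] with z h1 h2
        rw [fieldStep_eq_of_not_mem hV.eq_zero b h1, h2]
      rw [e2.fderiv_eq]
      exact (hasFDerivAt_conj (hV.contDiff.differentiable (by norm_num) _) _).fderiv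
    · push Not at hx
      left
      have e : ∀ b, ∀ᶠ z in 𝓝 x, unframe α g b z ∉ Box := fun b =>
        (isClosed_Box.preimage (continuous_unframe α g b)).isOpen_compl.mem_nhds (hx b)
      have e2 : fieldStep α u g V =ᶠ[𝓝 x] u := by
        filter_upwards [e true, e false] with z h1 h2
        rw [fieldStep_eq_of_not_mem hV.eq_zero false h1, hV.eq_zero _ h2]
        simp [Rot]
      exact e2.fderiv_eq
  refine ⟨?_, ?_, ?_, ?_, ?_, ?_⟩
  · have h1 := hV.contDiff
    have h2 := hu.contDiff
    unfold fieldStep Rot unframe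
    fun_prop
  · intro x hx
    have h1 : ∀ b, unframe α g b x ∉ Box := fun b hb => hx (h.mem_box hg hb)
    rw [fieldStep, hu.eq_zero x hx, hV.eq_zero _ (h1 _), hV.eq_zero _ (h1 _)]
    simp [Rot]
  · intro x
    rcases key x with e | ⟨y, e⟩
    · rw [e]
      exact hK x
    · rw [e]
      have hL : ‖(fderiv ℝ V y) ∘L (-α⁻¹ • rotL)‖ ≤ K * α⁻¹ := by
        refine (ContinuousLinearMap.opNorm_comp_le _ _).trans ?_
        rw [norm_smul, norm_neg, norm_inv, Real.norm_of_nonneg hα.le]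
        have := norm_rotL_le
        have hKy := hV.norm_fderiv_le y
        have : α⁻¹ * ‖rotL‖ ≤ α⁻¹ := mul_le_of_le_one_right (by positivity) this
        gcongr
        exact (norm_nonneg _).trans hKy
      have hR : ‖rotL ∘L (fderiv ℝ V y) ∘L (-α⁻¹ • rotL)‖ ≤ K * α⁻¹ := by
        refine (ContinuousLinearMap.opNorm_comp_le _ _).trans ?_
        exact (mul_le_of_le_one_left (norm_nonneg _) norm_rotL_le).trans hL
      rw [norm_smul, Real.norm_of_nonneg hα.le]
      calc α * _ ≤ α * (K * α⁻¹) := by gcongr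
        _ = K := by field_simp
  · intro x
    rcases key x with e | ⟨y, e⟩
    · rw [e]
      exact hu.div x
    · rw [e]
      have hd := hV.div y
      have e1 : ((-1 : ℝ), (0 : ℝ)) = -((1 : ℝ), (0 : ℝ)) := by simp
      simp [rotL_apply, Rot]
      rw [e1, map_neg, Prod.fst_neg]
      field_simp
      linarith
  · intro x
    have e1 : ∀ b, unframe α g b (x.1, -x.2) = (-(unframe α g b x).1, (unframe α g b x).2) := by
      intro b
      simp [unframe]
    rw [fieldStep, e1, e1, hV.symm_snd, hV.symm_snd, hu.symm_fst, fieldStep]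
    ext <;> simp [Rot]; ring
  · intro x
    have e1 : ∀ b, unframe α g b (-x.1, x.2) = ((unframe α g (!b) x).1, -(unframe α g (!b) x).2) := by
      intro b
      cases b <;> ext <;> simp [unframe, letterSign] <;> ring
    rw [fieldStep, e1, e1, hV.symm_fst, hV.symm_fst, hu.symm_snd, fieldStep]
    ext <;> simp [Rot] <;> ring

/-- The approximate velocities. -/
def approxField (α : ℝ) (u : ℝ × ℝ → ℝ × ℝ) (g : ℝ) : ℕ → ℝ × ℝ → ℝ × ℝ
  | 0 => 0
  | n + 1 => fieldStep α u g (approxField α u g n)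

theorem IsSeed.isApproxField_approxField {α γ : ℝ} (h : IsAdmissible α γ) {u : ℝ × ℝ → ℝ × ℝ}
    (hu : IsSeed α γ u) {K : ℝ} (hK : ∀ x, ‖fderiv ℝ u x‖ ≤ K) {g : ℝ} (hg : g ∈ Icc γ 1) (n : ℕ) :
    IsApproxField K (approxField α u g n) := by
  induction n with
  | zero => exact isApproxField_zero ((norm_nonneg _).trans (hK 0))
  | succ n ih => exact hu.isApproxField_fieldStep h hK hg ih

theorem IsApproxField.norm_sub_le {K : ℝ} {V : ℝ × ℝ → ℝ × ℝ} (hV : IsApproxField K V)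
    (x y : ℝ × ℝ) : ‖V x - V y‖ ≤ K * ‖x - y‖ :=
  convex_univ.norm_image_sub_le_of_norm_fderiv_le
    (fun z _ => hV.contDiff.differentiable (by norm_num) z) (fun z _ => hV.norm_fderiv_le z)
    (mem_univ y) (mem_univ x)

theorem norm_le_of_mem_Box {x : ℝ × ℝ} (hx : x ∈ Box) : ‖x‖ ≤ 2 := by
  obtain ⟨h1, h2, h3⟩ := hx
  have h4 : √2 ≤ 2 := Real.sqrt_le_iff.mpr (by norm_num)
  exact max_le (abs_le.mpr h1) (abs_le.mpr ⟨by linarith, by linarith⟩)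

theorem IsApproxField.norm_le {K : ℝ} {V : ℝ × ℝ → ℝ × ℝ} (hV : IsApproxField K V)
    (x : ℝ × ℝ) : ‖V x‖ ≤ 5 * K := by
  have hK : 0 ≤ K := (norm_nonneg _).trans (hV.norm_fderiv_le 0)
  by_cases hx : x ∈ Box
  · have h0 : V (3, 0) = 0 := hV.eq_zero _ fun h => by
      have := h.1.2
      norm_num at this
    have h1 := hV.norm_sub_le x (3, 0)
    rw [h0, sub_zero] at h1
    have h2 : ‖x - (3, 0)‖ ≤ 2 + 3 := (_root_.norm_sub_le _ _).trans
      (add_le_add (norm_le_of_mem_Box hx) (by simp [Prod.norm_def]))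
    calc ‖V x‖ ≤ K * ‖x - (3, 0)‖ := h1
      _ ≤ K * (2 + 3) := by gcongr
      _ = 5 * K := by ring
  · rw [hV.eq_zero x hx, norm_zero]
    positivity

theorem IsAdmissible.exists_not_mem {α γ : ℝ} (h : IsAdmissible α γ) {g g' : ℝ} (hg : g ∈ Icc γ 1)
    (hg' : g' ∈ Icc γ 1) (x : ℝ × ℝ) :
    ∃ b, unframe α g (!b) x ∉ Box ∧ unframe α g' (!b) x ∉ Box := by
  by_cases h1 : unframe α g true x ∈ Box
  · exact ⟨true, h.not_mem_box hg hg h1, h.not_mem_box hg hg' h1⟩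
  · by_cases h2 : unframe α g' true x ∈ Box
    · exact ⟨true, h.not_mem_box hg' hg h2, h.not_mem_box hg' hg' h2⟩
    · exact ⟨false, h1, h2⟩

theorem IsAdmissible.norm_fieldStep_sub_le {α γ : ℝ} (h : IsAdmissible α γ) (u : ℝ × ℝ → ℝ × ℝ)
    {g : ℝ} (hg : g ∈ Icc γ 1) {V W : ℝ × ℝ → ℝ × ℝ} (hV : ∀ y ∉ Box, V y = 0)
    (hW : ∀ y ∉ Box, W y = 0) {C : ℝ} (hC : ∀ y, ‖V y - W y‖ ≤ C) (x : ℝ × ℝ) :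
    ‖fieldStep α u g V x - fieldStep α u g W x‖ ≤ α * C := by
  obtain ⟨b, hb, -⟩ := h.exists_not_mem hg hg x
  rw [fieldStep_eq_of_not_mem hV b hb, fieldStep_eq_of_not_mem hW b hb, add_sub_add_left_eq_sub,
    ← smul_sub, ← Rot_sub, norm_smul, norm_Rot, Real.norm_of_nonneg h.pos.le]
  exact mul_le_mul_of_nonneg_left (hC _) h.pos.le

theorem norm_unframe_sub (α g g' : ℝ) (b : Bool) (x : ℝ × ℝ) :
    ‖unframe α g b x - unframe α g' b x‖ = |α⁻¹| * |g - g'| := by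
  cases b <;> simp [unframe, letterSign, Prod.norm_def, ← mul_sub,
    mul_nonneg, abs_sub_comm, neg_add_eq_sub]

theorem IsSeed.norm_approxField_sub_le {α γ : ℝ} (h : IsAdmissible α γ) {u : ℝ × ℝ → ℝ × ℝ}
    (hu : IsSeed α γ u) {K : ℝ} (hK : ∀ x, ‖fderiv ℝ u x‖ ≤ K) {g g' : ℝ} (hg : g ∈ Icc γ 1)
    (hg' : g' ∈ Icc γ 1) (n : ℕ) (x : ℝ × ℝ) :
    ‖approxField α u g n x - approxField α u g' n x‖ ≤ K / (1 - α) * |g - g'| := by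
  have hα := h.pos
  have hα1 : 0 < 1 - α := by linarith [h.lt_one]
  have hK0 : 0 ≤ K := (norm_nonneg _).trans (hK 0)
  induction n generalizing x with
  | zero =>
    simp only [approxField, Pi.zero_apply, sub_zero, norm_zero]
    positivity
  | succ n ih =>
    obtain ⟨b, hb, hb'⟩ := h.exists_not_mem hg hg' x
    have hV := hu.isApproxField_approxField h hK hg n
    have hV' := hu.isApproxField_approxField h hK hg' n
    rw [approxField, approxField, fieldStep_eq_of_not_mem hV.eq_zero b hb,
      fieldStep_eq_of_not_mem hV'.eq_zero b hb', add_sub_add_left_eq_sub,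
      ← smul_sub, ← Rot_sub, norm_smul, norm_Rot, Real.norm_of_nonneg h.pos.le]
    have h1 := ih (unframe α g b x)
    have h2 := hV'.norm_sub_le (unframe α g b x) (unframe α g' b x)
    rw [norm_unframe_sub, abs_of_pos (inv_pos.mpr hα)] at h2
    calc α * _ ≤ α * (K / (1 - α) * |g - g'| + K * (α⁻¹ * |g - g'|)) := by
          gcongr
          exact (norm_sub_le_norm_sub_add_norm_sub _ _ _).trans (add_le_add h1 h2)
      _ = K / (1 - α) * |g - g'| := by
          field_simp
          ring

open MeasureTheory

theorem IsApproxField.integral_dot2_grad2 {K : ℝ} {V : ℝ × ℝ → ℝ × ℝ} (hV : IsApproxField K V)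
    {ψ : ℝ × ℝ → ℝ} (hψ : ContDiff ℝ (⊤ : ℕ∞) ψ) (hc : HasCompactSupport ψ) :
    ∫ x, dot2 (V x) (grad2 ψ x) = 0 := by
  have hψ1 : ContDiff ℝ 1 ψ := hψ.of_le (by exact_mod_cast le_top)
  have hψd := hψ1.continuous_fderiv (by norm_num)
  have hV1 := hV.contDiff
  have parts : ∀ f : ℝ × ℝ → ℝ, ContDiff ℝ 1 f → ∀ v : ℝ × ℝ,
      Integrable (fun x => f x * fderiv ℝ ψ x v) ∧ Integrable (fun x => fderiv ℝ f x v * ψ x) ∧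
      ∫ x, f x * fderiv ℝ ψ x v = -∫ x, fderiv ℝ f x v * ψ x := by
    intro f hf v
    have hfd := hf.continuous_fderiv (by norm_num)
    have hc' : HasCompactSupport fun x => fderiv ℝ ψ x v :=
      (hc.fderiv ℝ).comp_left (g := fun L : ℝ × ℝ →L[ℝ] ℝ => L v) rfl
    have i1 : Integrable (fun x => f x * fderiv ℝ ψ x v) :=
      (hf.continuous.mul (hψd.clm_apply continuous_const)).integrable_of_hasCompactSupport
        hc'.mul_left
    have i2 : Integrable (fun x => fderiv ℝ f x v * ψ x) :=
      ((hfd.clm_apply continuous_const).mul hψ1.continuous).integrable_of_hasCompactSupport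
        hc.mul_left
    have i3 : Integrable (fun x => f x * ψ x) :=
      (hf.continuous.mul hψ1.continuous).integrable_of_hasCompactSupport hc.mul_left
    exact ⟨i1, i2, integral_mul_fderiv_eq_neg_fderiv_mul_of_integrable i2 i1 i3
      (fun x _ => hf.differentiable (by norm_num) x)
      (fun x _ => hψ1.differentiable (by norm_num) x)⟩
  obtain ⟨a1, a2, a3⟩ := parts (fun x => (V x).1) hV1.fst (1, 0)
  obtain ⟨b1, b2, b3⟩ := parts (fun x => (V x).2) hV1.snd (0, 1)
  simp only [dot2, grad2]
  rw [integral_add a1 b1, a3, b3, ← neg_add, ← integral_add a2 b2, neg_eq_zero]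
  refine integral_eq_zero_of_ae (Eventually.of_forall fun x => ?_)
  have hd : DifferentiableAt ℝ V x := hV1.differentiable (by norm_num) x
  have e1 : fderiv ℝ (fun x => (V x).1) x (1, 0) = (fderiv ℝ V x (1, 0)).1 := by
    rw [hd.hasFDerivAt.fst.fderiv]; rfl
  have e2 : fderiv ℝ (fun x => (V x).2) x (0, 1) = (fderiv ℝ V x (0, 1)).2 := by
    rw [hd.hasFDerivAt.snd.fderiv]; rfl
  simp only [e1, e2, ← add_mul, hV.div x, zero_mul, Pi.zero_apply]

/-- The properties of the limiting velocity, parametrised by the contraction factor `g`. -/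
structure IsSelfSimilarField (α γ : ℝ) (u : ℝ × ℝ → ℝ × ℝ) (K M : ℝ)
    (W : ℝ → ℝ × ℝ → ℝ × ℝ) : Prop where
  eq_zero : ∀ g ∈ Icc γ 1, ∀ x ∉ Box, W g x = 0
  norm_sub_le : ∀ g ∈ Icc γ 1, ∀ x y, ‖W g x - W g y‖ ≤ K * ‖x - y‖
  norm_param_sub_le : ∀ g ∈ Icc γ 1, ∀ g' ∈ Icc γ 1, ∀ x, ‖W g x - W g' x‖ ≤ M * |g - g'|
  norm_le : ∀ g ∈ Icc γ 1, ∀ x, ‖W g x‖ ≤ 5 * K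
  symm_fst : ∀ g ∈ Icc γ 1, ∀ x, W g (x.1, -x.2) = ((W g x).1, -(W g x).2)
  symm_snd : ∀ g ∈ Icc γ 1, ∀ x, W g (-x.1, x.2) = (-(W g x).1, (W g x).2)
  fieldStep_eq : ∀ g ∈ Icc γ 1, ∀ x, fieldStep α u g (W g) x = W g x
  integral_eq_zero : ∀ g ∈ Icc γ 1, ∀ ψ : ℝ × ℝ → ℝ, ContDiff ℝ (⊤ : ℕ∞) ψ →
    HasCompactSupport ψ → ∫ x, dot2 (W g x) (grad2 ψ x) = 0

theorem IsSeed.exists_tendsto_approxField {α γ : ℝ} (h : IsAdmissible α γ) {u : ℝ × ℝ → ℝ × ℝ}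
    (hu : IsSeed α γ u) {K : ℝ} (hK : ∀ x, ‖fderiv ℝ u x‖ ≤ K) {g : ℝ} (hg : g ∈ Icc γ 1)
    (x : ℝ × ℝ) : ∃ y, Tendsto (fun n => approxField α u g n x) atTop (𝓝 y) := by
  have hap := hu.isApproxField_approxField h hK hg
  have hdiff : ∀ n x, ‖approxField α u g n x - approxField α u g (n + 1) x‖ ≤ 5 * K * α ^ n := by
    intro n
    induction n with
    | zero =>
      intro x
      have := (hap 1).norm_le x
      simpa [approxField] using this
    | succ n ih =>
      intro x
      have := h.norm_fieldStep_sub_le u hg (hap n).eq_zero (hap (n + 1)).eq_zero ih x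
      refine this.trans_eq ?_
      ring
  have hcs : CauchySeq fun n => approxField α u g n x :=
    cauchySeq_of_le_geometric α (5 * K) h.lt_one fun n => by
      rw [dist_eq_norm]
      exact hdiff n x
  exact cauchySeq_tendsto_of_complete hcs

theorem IsSeed.exists_isSelfSimilarField {α γ : ℝ} (h : IsAdmissible α γ) {u : ℝ × ℝ → ℝ × ℝ}
    (hu : IsSeed α γ u) : ∃ K M W, 0 ≤ K ∧ 0 ≤ M ∧ IsSelfSimilarField α γ u K M W := by
  obtain ⟨K, hK0, hK⟩ := hu.exists_norm_fderiv_le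
  have hap := fun g hg => hu.isApproxField_approxField h hK (g := g) hg
  have hlim : ∀ g x, ∃ y, g ∈ Icc γ 1 → Tendsto (fun n => approxField α u g n x) atTop (𝓝 y) := by
    intro g x
    by_cases hg : g ∈ Icc γ 1
    · obtain ⟨y, hy⟩ := hu.exists_tendsto_approxField h hK hg x
      exact ⟨y, fun _ => hy⟩
    · exact ⟨0, fun hg' => absurd hg' hg⟩
  choose W hW using hlim
  have hα1 : 0 < 1 - α := by linarith [h.lt_one]
  refine ⟨K, K / (1 - α), W, hK0, by positivity, ?_, ?_, ?_, ?_, ?_, ?_, ?_, ?_⟩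
  · intro g hg x hx
    refine tendsto_nhds_unique (hW g x hg) ?_
    simp only [fun n => (hap g hg n).eq_zero x hx]
    exact tendsto_const_nhds
  · intro g hg x y
    exact le_of_tendsto ((hW g x hg).sub (hW g y hg)).norm
      (Eventually.of_forall fun n => (hap g hg n).norm_sub_le x y)
  · intro g hg g' hg' x
    exact le_of_tendsto ((hW g x hg).sub (hW g' x hg')).norm
      (Eventually.of_forall fun n => hu.norm_approxField_sub_le h hK hg hg' n x)
  · intro g hg x
    exact le_of_tendsto (hW g x hg).norm (Eventually.of_forall fun n => (hap g hg n).norm_le x)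
  · intro g hg x
    refine tendsto_nhds_unique (hW g _ hg) ?_
    simp only [fun n => (hap g hg n).symm_fst x]
    exact (hW g x hg).fst_nhds.prodMk_nhds (hW g x hg).snd_nhds.neg
  · intro g hg x
    refine tendsto_nhds_unique (hW g _ hg) ?_
    simp only [fun n => (hap g hg n).symm_snd x]
    exact (hW g x hg).fst_nhds.neg.prodMk_nhds (hW g x hg).snd_nhds
  · intro g hg x
    have t1 : ∀ b, Tendsto (fun n => α • Rot (approxField α u g n (unframe α g b x))) atTop
        (𝓝 (α • Rot (W g (unframe α g b x)))) := fun b =>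
      ((continuous_Rot.tendsto _).comp (hW g (unframe α g b x) hg)).const_smul α
    exact tendsto_nhds_unique ((tendsto_const_nhds.add (t1 true)).add (t1 false))
      ((tendsto_add_atTop_iff_nat 1).mpr (hW g x hg))
  · intro g hg ψ hψ hc
    have hψd := hψ.continuous_fderiv (by norm_num)
    have hcv : ∀ v, HasCompactSupport fun x => fderiv ℝ ψ x v := fun v =>
      (hc.fderiv ℝ).comp_left (g := fun L : ℝ × ℝ →L[ℝ] ℝ => L v) rfl
    have hgi : ∀ v, Integrable fun x => ‖fderiv ℝ ψ x v‖ := fun v =>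
      ((hψd.clm_apply continuous_const).integrable_of_hasCompactSupport (hcv v)).norm
    have hgc : Continuous (grad2 ψ) :=
      (hψd.clm_apply continuous_const).prodMk (hψd.clm_apply continuous_const)
    have ht := tendsto_integral_of_dominated_convergence
      (F := fun n x => dot2 (approxField α u g n x) (grad2 ψ x))
      (f := fun x => dot2 (W g x) (grad2 ψ x)) (μ := volume)
      (fun x => 5 * K * ‖fderiv ℝ ψ x (1, 0)‖ + 5 * K * ‖fderiv ℝ ψ x (0, 1)‖)
      (fun n => by
        have h1 := (hap g hg n).contDiff.continuous
        have : Continuous fun x => dot2 (approxField α u g n x) (grad2 ψ x) := by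
          unfold dot2
          fun_prop
        exact this.aestronglyMeasurable)
      (((hgi _).const_mul _).add ((hgi _).const_mul _))
      (fun n => Eventually.of_forall fun x => by
        have h1 := (hap g hg n).norm_le x
        have h2 := (norm_fst_le _).trans h1
        have h3 := (norm_snd_le _).trans h1
        refine (norm_add_le _ _).trans ?_
        rw [norm_mul, norm_mul]
        simp only [grad2]
        gcongr)
      (Eventually.of_forall fun x => by
        exact ((hW g x hg).fst_nhds.mul_const _).add ((hW g x hg).snd_nhds.mul_const _))
    simp only [fun n => (hap g hg n).integral_dot2_grad2 hψ hc] at ht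
    exact tendsto_nhds_unique ht tendsto_const_nhds

/-- The contraction factor at time `t`, interpolating linearly between `1` and `γ`. -/
def factor (γ t : ℝ) : ℝ := 1 - t * (1 - γ)

theorem IsAdmissible.factor_mem {α γ : ℝ} (h : IsAdmissible α γ) {t : ℝ} (ht : t ∈ Icc (0 : ℝ) 1) :
    factor γ t ∈ Icc γ 1 := by
  have := h.gamma_lt
  constructor <;> unfold factor <;> nlinarith [ht.1, ht.2]

open Classical in
/-- The time-dependent velocity, extended by zero outside the time interval `[0, 1]`. -/
def velocity (γ : ℝ) (W : ℝ → ℝ × ℝ → ℝ × ℝ) (t : ℝ) (x : ℝ × ℝ) : ℝ × ℝ :=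
  if t ∈ Icc (0 : ℝ) 1 then W (factor γ t) x else 0

theorem velocity_of_mem {γ : ℝ} {W : ℝ → ℝ × ℝ → ℝ × ℝ} {t : ℝ} (ht : t ∈ Icc (0 : ℝ) 1)
    (x : ℝ × ℝ) : velocity γ W t x = W (factor γ t) x := if_pos ht

theorem velocity_of_not_mem {γ : ℝ} {W : ℝ → ℝ × ℝ → ℝ × ℝ} {t : ℝ} (ht : t ∉ Icc (0 : ℝ) 1)
    (x : ℝ × ℝ) : velocity γ W t x = 0 := if_neg ht

section Velocity

variable {α γ : ℝ} {u : ℝ × ℝ → ℝ × ℝ} {K M : ℝ}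
  {W : ℝ → ℝ × ℝ → ℝ × ℝ}

theorem velocity_lipschitzWith (h : IsAdmissible α γ)
    (hW : IsSelfSimilarField α γ u K M W) (hK : 0 ≤ K) (t : ℝ) :
    LipschitzWith K.toNNReal (velocity γ W t) := by
  refine LipschitzWith.of_dist_le_mul fun x y => ?_
  rw [Real.coe_toNNReal K hK, dist_eq_norm, dist_eq_norm]
  by_cases ht : t ∈ Icc (0 : ℝ) 1
  · rw [velocity_of_mem ht, velocity_of_mem ht]
    exact hW.norm_sub_le _ (h.factor_mem ht) x y
  · rw [velocity_of_not_mem ht, velocity_of_not_mem ht, sub_zero, norm_zero]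
    positivity

theorem velocity_lipschitzOnWith (h : IsAdmissible α γ)
    (hW : IsSelfSimilarField α γ u K M W) (hK : 0 ≤ K) (hM : 0 ≤ M) :
    LipschitzOnWith (K + M).toNNReal (Function.uncurry (velocity γ W))
      (Icc (0 : ℝ) 1 ×ˢ (univ : Set (ℝ × ℝ))) := by
  refine LipschitzOnWith.of_dist_le_mul ?_
  rintro ⟨t, x⟩ ⟨ht, -⟩ ⟨s, y⟩ ⟨hs, -⟩
  rw [Real.coe_toNNReal _ (add_nonneg hK hM), dist_eq_norm, dist_eq_norm]
  simp only [Function.uncurry_apply_pair, velocity_of_mem ht, velocity_of_mem hs]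
  have h1 := hW.norm_sub_le _ (h.factor_mem ht) x y
  have h2 := hW.norm_param_sub_le _ (h.factor_mem ht) _ (h.factor_mem hs) y
  have h3 : |factor γ t - factor γ s| ≤ |t - s| := by
    have e : factor γ t - factor γ s = (t - s) * -(1 - γ) := by
      unfold factor
      ring
    have := h.gamma_lt
    have : 0 < γ := (mul_nonneg (Real.sqrt_nonneg 2) h.pos.le).trans_lt h.lt_gamma
    rw [e, abs_mul, abs_neg, abs_of_nonneg (show 0 ≤ 1 - γ by linarith)]
    exact mul_le_of_le_one_right (abs_nonneg _) (by linarith)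
  have h4 : ‖x - y‖ ≤ ‖(t, x) - (s, y)‖ := norm_snd_le ((t, x) - (s, y))
  have h5 : |t - s| ≤ ‖(t, x) - (s, y)‖ := norm_fst_le ((t, x) - (s, y))
  calc ‖W (factor γ t) x - W (factor γ s) y‖
      ≤ ‖W (factor γ t) x - W (factor γ t) y‖ + ‖W (factor γ t) y - W (factor γ s) y‖ :=
        norm_sub_le_norm_sub_add_norm_sub _ _ _
    _ ≤ K * ‖x - y‖ + M * |factor γ t - factor γ s| := add_le_add h1 h2
    _ ≤ K * ‖(t, x) - (s, y)‖ + M * ‖(t, x) - (s, y)‖ := by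
        gcongr
        exact h3.trans h5
    _ = (K + M) * ‖(t, x) - (s, y)‖ := by ring

theorem velocity_continuousOn (h : IsAdmissible α γ)
    (hW : IsSelfSimilarField α γ u K M W) (hK : 0 ≤ K) (hM : 0 ≤ M) (x : ℝ × ℝ) :
    ContinuousOn (fun t => velocity γ W t x) (Icc 0 1) :=
  (velocity_lipschitzOnWith h hW hK hM).continuousOn.comp (f := fun t => (t, x))
    (by fun_prop) fun _ ht => ⟨ht, mem_univ _⟩

theorem velocity_eq_zero (h : IsAdmissible α γ)
    (hW : IsSelfSimilarField α γ u K M W) {x : ℝ × ℝ} (hx : x ∉ Box) (t : ℝ) : velocity γ W t x = 0 := by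
  by_cases ht : t ∈ Icc (0 : ℝ) 1
  · rw [velocity_of_mem ht, hW.eq_zero _ (h.factor_mem ht) x hx]
  · exact velocity_of_not_mem ht x

theorem velocity_norm_le (h : IsAdmissible α γ)
    (hW : IsSelfSimilarField α γ u K M W) (hK : 0 ≤ K) (t : ℝ) (x : ℝ × ℝ) :
    ‖velocity γ W t x‖ ≤ (5 * K).toNNReal := by
  rw [Real.coe_toNNReal _ (by positivity)]
  by_cases ht : t ∈ Icc (0 : ℝ) 1
  · rw [velocity_of_mem ht]
    exact hW.norm_le _ (h.factor_mem ht) x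
  · rw [velocity_of_not_mem ht, norm_zero]
    positivity

theorem velocity_hasCompactSupport (h : IsAdmissible α γ)
    (hW : IsSelfSimilarField α γ u K M W) : HasCompactSupport (Function.uncurry (velocity γ W)) := by
  refine HasCompactSupport.intro ((isCompact_Icc (a := (0 : ℝ)) (b := 1)).prod isCompact_Box) ?_
  rintro ⟨t, x⟩ hx
  by_cases ht : t ∈ Icc (0 : ℝ) 1
  · exact velocity_eq_zero h hW (fun hx' => hx ⟨ht, hx'⟩) t
  · exact velocity_of_not_mem ht x

theorem velocity_symm_fst (h : IsAdmissible α γ)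
    (hW : IsSelfSimilarField α γ u K M W) (t : ℝ) (x : ℝ × ℝ) :
    velocity γ W t (x.1, -x.2) = ((velocity γ W t x).1, -(velocity γ W t x).2) := by
  by_cases ht : t ∈ Icc (0 : ℝ) 1
  · simp only [velocity_of_mem ht, hW.symm_fst _ (h.factor_mem ht) x]
  · simp [velocity_of_not_mem ht, Prod.zero_eq_mk]

theorem velocity_zero (h : IsAdmissible α γ)
    (hW : IsSelfSimilarField α γ u K M W) (t : ℝ) : velocity γ W t 0 = 0 := by
  by_cases ht : t ∈ Icc (0 : ℝ) 1
  · rw [velocity_of_mem ht]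
    have h1 := hW.symm_fst _ (h.factor_mem ht) 0
    have h2 := hW.symm_snd _ (h.factor_mem ht) 0
    simp only [Prod.fst_zero, Prod.snd_zero, neg_zero] at h1 h2
    have h1' := congrArg Prod.snd h1
    have h2' := congrArg Prod.fst h2
    simp only [Prod.mk_zero_zero] at h1' h2'
    ext
    · simp only [Prod.fst_zero]
      linarith
    · simp only [Prod.snd_zero]
      linarith
  · exact velocity_of_not_mem ht 0

theorem velocity_frame (h : IsAdmissible α γ)
    (hW : IsSelfSimilarField α γ u K M W) (hu : IsSeed α γ u) {t : ℝ} (ht : t ∈ Icc (0 : ℝ) 1) (b : Bool)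
    {y : ℝ × ℝ} (hy : y ∈ Box) : velocity γ W t (frame α (factor γ t) b y) =
      (-(letterSign b * (1 - γ)), 0) + α • Rot (velocity γ W t y) := by
  have hg := h.factor_mem ht
  have hy' : unframe α (factor γ t) b (frame α (factor γ t) b y) ∈ Box := by
    rwa [h.unframe_frame]
  rw [velocity_of_mem ht, velocity_of_mem ht, ← hW.fieldStep_eq _ hg,
    fieldStep_eq_of_not_mem (hW.eq_zero _ hg) b (h.not_mem_box hg hg hy'),
    (hu.eventuallyEq _ hg b _ hy').eq_of_nhds, h.unframe_frame]

theorem isUnitCurve_frame (h : IsAdmissible α γ)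
    (hW : IsSelfSimilarField α γ u K M W) (hu : IsSeed α γ u) {f : ℝ → ℝ × ℝ} (hf : IsUnitCurve (velocity γ W) f)
    (hfB : ∀ t ∈ Icc (0 : ℝ) 1, f t ∈ Box) (b : Bool) :
    IsUnitCurve (velocity γ W) fun t => frame α (factor γ t) b (f t) := by
  intro t ht
  rw [velocity_frame h hW hu ht b (hfB t ht)]
  have e : (fun t => frame α (factor γ t) b (f t)) =
      fun t => (letterSign b * factor γ t, (0 : ℝ)) + α • rotL (f t) := by
    funext s
    ext <;> simp [frame, rotL_apply, Rot]; ring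
  rw [e]
  have h1 : HasDerivWithinAt (fun t => (letterSign b * factor γ t, (0 : ℝ)))
      (-(letterSign b * (1 - γ)), 0) (Icc 0 1) t := by
    have := ((((hasDerivAt_id t).mul_const (1 - γ)).const_sub 1).const_mul
      (letterSign b)).prodMk (hasDerivAt_const t (0 : ℝ))
    exact this.hasDerivWithinAt.congr_deriv (by ext <;> simp; ring)
  exact h1.add ((rotL.hasFDerivAt.comp_hasDerivWithinAt t (hf t ht)).const_smul α)

theorem isUnitCurve_reflect (h : IsAdmissible α γ)
    (hW : IsSelfSimilarField α γ u K M W) {f : ℝ → ℝ × ℝ} (hf : IsUnitCurve (velocity γ W) f) :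
    IsUnitCurve (velocity γ W) fun t => ((f t).1, -(f t).2) := by
  intro t ht
  rw [velocity_symm_fst h hW]
  have h1 := (ContinuousLinearMap.fst ℝ ℝ ℝ).hasFDerivAt.comp_hasDerivWithinAt t (hf t ht)
  have h2 := (ContinuousLinearMap.snd ℝ ℝ ℝ).hasFDerivAt.comp_hasDerivWithinAt t (hf t ht)
  exact h1.prodMk h2.neg

theorem IsUnitCurve.mem_box (h : IsAdmissible α γ)
    (hW : IsSelfSimilarField α γ u K M W) (hK : 0 ≤ K) {f : ℝ → ℝ × ℝ} (hf : IsUnitCurve (velocity γ W) f)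
    (h0 : f 0 ∈ Box) {t : ℝ} (ht : t ∈ Icc (0 : ℝ) 1) : f t ∈ Box := by
  by_contra hb
  have hc : IsUnitCurve (velocity γ W) fun _ => f t := by
    intro s _
    rw [velocity_eq_zero h hW hb]
    exact hasDerivWithinAt_const _ _ _
  have := hf.eq_zero_of_eq (velocity_lipschitzWith h hW hK) hc ht rfl
  exact hb (this ▸ h0)

end Velocity

theorem ISeg_subset_Box : ISeg ⊆ Box := by
  rintro ⟨x, y⟩ ⟨⟨h1, h2⟩, h3⟩
  simp only [mem_singleton_iff] at h3
  simp only at h1 h2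
  have := Real.sqrt_nonneg 2
  refine ⟨⟨?_, ?_⟩, ?_, ?_⟩ <;> simp only <;> linarith

theorem Fb_eq_frame (α : ℝ) (b : Bool) (x : ℝ × ℝ) : Fb α b x = frame α 1 b x := by
  cases b <;> ext <;> simp [Fb, F1, F2, Rot, frame, letterSign] <;> ring

theorem smul_frame_one (α g : ℝ) (b : Bool) (x : ℝ × ℝ) :
    g • frame α 1 b x = frame α g b (g • x) := by
  ext <;> simp [frame] <;> ring

theorem IsAdmissible.Fb_mem_box {α γ : ℝ} (h : IsAdmissible α γ) (b : Bool) {x : ℝ × ℝ}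
    (hx : x ∈ Box) : Fb α b x ∈ Box := by
  refine h.mem_box (g := 1) (b := b) ⟨h.gamma_lt.le, le_rfl⟩ ?_
  rwa [Fb_eq_frame, h.unframe_frame]

theorem IsAdmissible.Fw_mem_box {α γ : ℝ} (h : IsAdmissible α γ) (w : List Bool) {x : ℝ × ℝ}
    (hx : x ∈ Box) : Fw α w x ∈ Box := by
  induction w with
  | nil => exact hx
  | cons b w ih => exact h.Fb_mem_box b ih

theorem IsAdmissible.isCompact_Sset {α γ : ℝ} (h : IsAdmissible α γ) : IsCompact (Sset α) := by
  refine isCompact_Box.of_isClosed_subset isClosed_closure (closure_minimal ?_ isClosed_Box)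
  refine iUnion_subset fun w => ?_
  rintro _ ⟨x, hx, rfl⟩
  exact h.Fw_mem_box w (ISeg_subset_Box hx)

/-- A continuous map commuting with the similarities up to the change of scale, and mapping the
segment to its rescaling, maps `Sset α` to its rescaling. -/
theorem IsAdmissible.image_Sset {α γ : ℝ} (h : IsAdmissible α γ) {Φ : ℝ × ℝ → ℝ × ℝ}
    (hc : Continuous Φ) (hI : Φ '' ISeg = (fun x => γ • x) '' ISeg)
    (hF : ∀ b, ∀ x ∈ Box, Φ (Fb α b x) = frame α γ b (Φ x)) :
    Φ '' Sset α = (fun x => γ • x) '' Sset α := by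
  have hw : ∀ w, Φ '' (Fw α w '' ISeg) = (fun x => γ • x) '' (Fw α w '' ISeg) := by
    intro w
    induction w with
    | nil => simpa [Fw] using hI
    | cons b w ih =>
      have e1 : Fw α (b :: w) '' ISeg = Fb α b '' (Fw α w '' ISeg) := by
        rw [← image_comp]
        rfl
      have e2 : Φ '' (Fb α b '' (Fw α w '' ISeg)) = frame α γ b '' (Φ '' (Fw α w '' ISeg)) := by
        rw [image_image Φ, image_image (frame α γ b)]
        refine image_congr ?_
        rintro _ ⟨x, hx, rfl⟩
        exact hF b _ (h.Fw_mem_box w (ISeg_subset_Box hx))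
      rw [e1, e2, ih, image_image (frame α γ b), image_image (fun x => γ • x)]
      refine image_congr fun x _ => ?_
      rw [Fb_eq_frame, smul_frame_one]
  have hcs := h.isCompact_Sset
  rw [Sset] at hcs ⊢
  rw [image_closure_of_isCompact hcs hc.continuousOn,
    image_closure_of_isCompact hcs (by fun_prop), image_iUnion, image_iUnion]
  simp only [hw]

/-- A continuous injective map that preserves the horizontal axis and rescales `(±1, 0)` by `γ`
rescales the segment. -/
theorem image_ISeg {γ : ℝ} (hγ : 0 < γ) {Φ : ℝ × ℝ → ℝ × ℝ} (hc : Continuous Φ)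
    (hinj : Function.Injective Φ) (haxis : ∀ x : ℝ, (Φ (x, 0)).2 = 0)
    (h1 : Φ (1, 0) = (γ, 0)) (h2 : Φ (-1, 0) = (-γ, 0)) :
    Φ '' ISeg = (fun x => γ • x) '' ISeg := by
  let f : ℝ → ℝ := fun x => (Φ (x, 0)).1
  have hf : Continuous f := by fun_prop
  have hΦ : ∀ x, Φ (x, 0) = (f x, 0) := fun x => Prod.ext rfl (haxis x)
  have hfi : Function.Injective f := fun x y hxy => by
    have : Φ (x, 0) = Φ (y, 0) := by rw [hΦ, hΦ, hxy]
    exact congrArg Prod.fst (hinj this)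
  have f1 : f 1 = γ := by simp [f, h1]
  have f2 : f (-1) = -γ := by simp [f, h2]
  have hmono : StrictMonoOn f (Icc (-1) 1) := hf.continuousOn.strictMonoOn_of_injOn_Icc
    (by norm_num) (by rw [f1, f2]; linarith) hfi.injOn
  have hfI : f '' Icc (-1) 1 = Icc (-γ) γ := by
    rw [← f1, ← f2.trans (congrArg _ f1.symm)]
    refine Subset.antisymm ?_ (intermediate_value_Icc (by norm_num) hf.continuousOn)
    rintro _ ⟨x, hx, rfl⟩
    exact ⟨hmono.monotoneOn (by simp) hx hx.1, hmono.monotoneOn hx (by simp) hx.2⟩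
  ext ⟨p, q⟩
  constructor
  · rintro ⟨⟨x, y⟩, ⟨hx, rfl⟩, hpq⟩
    have hfx : f x ∈ Icc (-γ) γ := hfI ▸ mem_image_of_mem f hx
    rw [hΦ] at hpq
    refine ⟨(f x / γ, 0), ⟨⟨?_, ?_⟩, rfl⟩, ?_⟩
    · rw [le_div_iff₀ hγ]
      linarith [hfx.1]
    · rw [div_le_iff₀ hγ]
      linarith [hfx.2]
    · rw [← hpq]
      ext <;> simp
      field_simp
  · rintro ⟨⟨x, y⟩, ⟨hx, rfl⟩, hpq⟩
    have hfx : γ * x ∈ Icc (-γ) γ := ⟨by nlinarith [hx.1], by nlinarith [hx.2]⟩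
    rw [← hfI] at hfx
    obtain ⟨z, hz, hzx⟩ := hfx
    refine ⟨(z, 0), ⟨hz, rfl⟩, ?_⟩
    rw [hΦ, hzx, ← hpq]
    ext <;> simp

theorem isAdmissible_of_mem_Ioo {α : ℝ} (hα : α ∈ Ioo (1 / 2 : ℝ) (√2)⁻¹) :
    IsAdmissible α (3 / 4 + α / (2 * √2)) := by
  have hr : 0 < √2 := Real.sqrt_pos.mpr (by norm_num)
  have hr2 : √2 * √2 = 2 := Real.mul_self_sqrt (by norm_num)
  obtain ⟨h1, h2⟩ := hα
  have hs : √2 * α < 1 := by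
    have := mul_lt_mul_of_pos_left h2 hr
    rwa [mul_inv_cancel₀ hr.ne'] at this
  have e : α / (2 * √2) = √2 * α / 4 := by
    field_simp
    nlinarith
  have hr1 : 1 < √2 := by nlinarith
  rw [e]
  refine ⟨by linarith, by nlinarith, by linarith, by linarith, by linarith, by nlinarith⟩

end Seed

/-- For `α ∈ (1/2, 1/√2)` and `γ_α = 3/4 + α/(2√2)` there is a
velocity `U`, Lipschitz on `[0,1] × ℝ²`, compactly supported and weakly divergence
free, whose unique trajectory map `X` on `ℝ²` satisfies `X 1 '' S_α = γ_α • S_α`. -/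
theorem statement15 (α : ℝ) (hα : α ∈ Ioo (1/2 : ℝ) (Real.sqrt 2)⁻¹)
    (γ : ℝ) (hγ : γ = 3/4 + α / (2 * Real.sqrt 2)) :
    ∃ (U : ℝ → ℝ × ℝ → ℝ × ℝ) (X : ℝ → ℝ × ℝ → ℝ × ℝ),
      (∃ K : NNReal, LipschitzOnWith K (Function.uncurry U)
        (Icc (0 : ℝ) 1 ×ˢ (univ : Set (ℝ × ℝ)))) ∧
      HasCompactSupport (Function.uncurry U) ∧
      (∀ t ∈ Icc (0 : ℝ) 1, WeakDivFreeAt U t) ∧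
      IsTrajOn 1 U univ X ∧
      (∀ X' : ℝ → ℝ × ℝ → ℝ × ℝ, IsTrajOn 1 U univ X' →
        ∀ t ∈ Icc (0 : ℝ) 1, ∀ a, X' t a = X t a) ∧
      X 1 '' Sset α = (fun x : ℝ × ℝ => γ • x) '' Sset α := by
  have h : IsAdmissible α γ := hγ ▸ isAdmissible_of_mem_Ioo hα
  have hγ0 : 0 < γ := (mul_nonneg (Real.sqrt_nonneg 2) h.pos.le).trans_lt h.lt_gamma
  obtain ⟨u, hu⟩ := h.exists_isSeed
  obtain ⟨K, M, W, hK, hM, hW⟩ := hu.exists_isSelfSimilarField h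
  have hlip := velocity_lipschitzWith h hW hK
  choose f f0 hf using fun a => exists_isUnitCurve hlip (velocity_continuousOn h hW hK hM)
    (velocity_norm_le h hW hK) a
  have one_mem : (1 : ℝ) ∈ Icc (0 : ℝ) 1 := right_mem_Icc.mpr zero_le_one
  have hcurve : ∀ (a : ℝ × ℝ) (k : ℝ → ℝ × ℝ), IsUnitCurve (velocity γ W) k → k 0 = a →
      f a 1 = k 1 := fun a k hk h0 => (hf a).eqOn hlip hk ((f0 a).trans h0.symm) one_mem
  have hcont : Continuous fun a => f a 1 := by
    refine (LipschitzWith.of_dist_le_mul (K := (Real.exp (K.toNNReal * (1 - 0))).toNNReal)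
      fun a b => ?_).continuous
    rw [Real.coe_toNNReal _ (Real.exp_pos _).le, mul_comm]
    have := (hf a).dist_le hlip (hf b) one_mem
    rwa [f0, f0] at this
  have hframe : ∀ b, ∀ x ∈ Box, f (Fb α b x) 1 = frame α γ b (f x 1) := by
    intro b x hx
    have hB : ∀ t ∈ Icc (0 : ℝ) 1, f x t ∈ Box := fun t ht =>
      (hf x).mem_box h hW hK (by rwa [f0]) ht
    rw [hcurve _ _ (isUnitCurve_frame h hW hu (hf x) hB b)
      (by simp [f0, factor, Fb_eq_frame])]
    simp [factor]
  have hzero : f 0 1 = 0 := hcurve 0 (fun _ => 0) (fun t _ => by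
    rw [velocity_zero h hW]
    exact hasDerivWithinAt_const _ _ _) rfl
  have hend : ∀ b, f (letterSign b, 0) 1 = (letterSign b * γ, 0) := by
    intro b
    have h1 := hframe b 0 (ISeg_subset_Box (by simp [ISeg]))
    have h2 : Fb α b 0 = (letterSign b, 0) := by simp [Fb_eq_frame, frame]
    rw [h2, hzero] at h1
    simpa [frame] using h1
  refine ⟨velocity γ W, fun t a => f a t, ⟨_, velocity_lipschitzOnWith h hW hK hM⟩,
    velocity_hasCompactSupport h hW, fun t ht ψ hψ hc => ?_, fun a _ => ⟨f0 a, hf a⟩,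
    fun X' hX' t ht a => ?_, ?_⟩
  · simp only [velocity_of_mem ht]
    exact hW.integral_eq_zero _ (h.factor_mem ht) ψ hψ hc
  · obtain ⟨h0, hd⟩ := hX' a (mem_univ a)
    have hd : IsUnitCurve (velocity γ W) fun t => X' t a := hd
    exact hd.eqOn hlip (hf a) (h0.trans (f0 a).symm) ht
  · refine h.image_Sset hcont (image_ISeg hγ0 hcont ?_ ?_ ?_ ?_) hframe
    · intro a b hab
      have := (hf a).eq_zero_of_eq hlip (hf b) one_mem hab
      rwa [f0, f0] at this
    · intro x
      have h1 := hcurve (x, 0) _ (isUnitCurve_reflect h hW (hf (x, 0))) (by simp [f0])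
      have h2 := congrArg Prod.snd h1
      simp only at h2 ⊢
      linarith
    · simpa [letterSign] using hend true
    · simpa [letterSign] using hend false

end
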